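/- arXiv:2301.01963 — 2 statements merged into one kernel-verified Lean document; each statement's English description precedes it below -/
import Mathlib

section
/- Let n ≥ 1, let d > 4n, and let L_d be the free nilpotent Lie algebra of class 2 on d generators x₁,…,x_d over a field Ω. Let M be the ideal of L_d generated by the elements [x_{4k+1}, x_{4k+2}] + [x_{4k+3}, x_{4k+4}] for k = 0, 1, …, n−1. Then the quotient Lie algebra L_d/M is nilpotent of class 2 and dim_Ω B₀(L_d/M) = n. -/
variable (Ω : Type*) [Field Ω] (L : Type*) [LieRing L] [LieAlgebra Ω L]

/-- `K(L)`: the set of brackets of a Lie algebra `L`. -/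
def bracketSet : Set L := {z | ∃ x y : L, z = ⁅x, y⁆}

/-- `f : L × L → Ω` is a 2-cocycle (with values in the trivial module `Ω`) if it is
bilinear, alternating and satisfies the cocycle identity. -/
def IsTwoCocycle (f : L → L → Ω) : Prop :=
  (∀ x x' y : L, f (x + x') y = f x y + f x' y) ∧
  (∀ x y y' : L, f x (y + y') = f x y + f x y') ∧
  (∀ (a : Ω) (x y : L), f (a • x) y = a * f x y) ∧
  (∀ (a : Ω) (x y : L), f x (a • y) = a * f x y) ∧
  (∀ x : L, f x x = 0) ∧
  (∀ x y z : L, f ⁅x, y⁆ z + f ⁅y, z⁆ x + f ⁅z, x⁆ y = 0)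

/-- `f : L × L → Ω` is a 2-coboundary if `f (x, y) = -σ ⁅x, y⁆` for some linear `σ`. -/
def IsTwoCoboundary (f : L → L → Ω) : Prop :=
  ∃ σ : L →ₗ[Ω] Ω, ∀ x y : L, f x y = -σ ⁅x, y⁆

/-- The subspace of 2-cocycles inside the space of all maps `L → L → Ω`. -/
def twoCocycles : Submodule Ω (L → L → Ω) where
  carrier := {f | IsTwoCocycle Ω L f}
  add_mem' := by
    rintro f g ⟨hf1, hf2, hf3, hf4, hf5, hf6⟩ ⟨hg1, hg2, hg3, hg4, hg5, hg6⟩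
    refine ⟨fun x x' y => ?_, fun x y y' => ?_, fun a x y => ?_, fun a x y => ?_,
      fun x => ?_, fun x y z => ?_⟩ <;>
      simp only [Pi.add_apply]
    · rw [hf1, hg1]; ring
    · rw [hf2, hg2]; ring
    · rw [hf3, hg3]; ring
    · rw [hf4, hg4]; ring
    · rw [hf5, hg5]; ring
    · linear_combination hf6 x y z + hg6 x y z
  zero_mem' := by
    refine ⟨?_, ?_, ?_, ?_, ?_, ?_⟩ <;> simp
  smul_mem' := by
    rintro c f ⟨hf1, hf2, hf3, hf4, hf5, hf6⟩
    refine ⟨fun x x' y => ?_, fun x y y' => ?_, fun a x y => ?_, fun a x y => ?_,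
      fun x => ?_, fun x y z => ?_⟩ <;>
      simp only [Pi.smul_apply, smul_eq_mul]
    · rw [hf1]; ring
    · rw [hf2]; ring
    · rw [hf3]; ring
    · rw [hf4]; ring
    · rw [hf5]; ring
    · linear_combination c * hf6 x y z

/-- The subspace of 2-coboundaries inside the space of all maps `L → L → Ω`. -/
def twoCoboundaries : Submodule Ω (L → L → Ω) where
  carrier := {f | IsTwoCoboundary Ω L f}
  add_mem' := by
    rintro f g ⟨σ, hσ⟩ ⟨τ, hτ⟩
    refine ⟨σ + τ, fun x y => ?_⟩
    simp only [Pi.add_apply, LinearMap.add_apply, hσ x y, hτ x y]; ring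
  zero_mem' := ⟨0, by simp⟩
  smul_mem' := by
    rintro c f ⟨σ, hσ⟩
    refine ⟨c • σ, fun x y => ?_⟩
    simp only [Pi.smul_apply, LinearMap.smul_apply, hσ x y, smul_eq_mul]; ring

/-- The 2-coboundaries viewed as a subspace of the space of 2-cocycles. -/
def twoCoboundariesIn : Submodule Ω (twoCocycles Ω L) :=
  (twoCoboundaries Ω L).comap (twoCocycles Ω L).subtype

/-- The second cohomology `H²(L,Ω)` of `L` with coefficients in the trivial module `Ω`:
2-cocycles modulo 2-coboundaries. -/
abbrev lieH2 := twoCocycles Ω L ⧸ twoCoboundariesIn Ω L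

/-- The cohomology class of a 2-cocycle. -/
def H2class (f : L → L → Ω) (hf : f ∈ twoCocycles Ω L) : lieH2 Ω L :=
  Submodule.Quotient.mk ⟨f, hf⟩

/-- The subspace of maps `L → L → Ω` vanishing on all pairs of commuting elements. -/
def vanishingOnCommuting : Submodule Ω (L → L → Ω) where
  carrier := {f | ∀ x y : L, ⁅x, y⁆ = 0 → f x y = 0}
  add_mem' := by
    intro f g hf hg x y hxy
    simp [Pi.add_apply, hf x y hxy, hg x y hxy]
  zero_mem' := fun x y _ => rfl
  smul_mem' := by
    intro c f hf x y hxy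
    simp [Pi.smul_apply, hf x y hxy]

/-- The Bogomolov multiplier `B₀(L)`: the subspace of `H²(L,Ω)` consisting of the classes
of 2-cocycles `f` such that `f (x, y) = 0` whenever `⁅x, y⁆ = 0`. -/
def B0 : Submodule Ω (lieH2 Ω L) :=
  Submodule.map (twoCoboundariesIn Ω L).mkQ
    ((vanishingOnCommuting Ω L).comap (twoCocycles Ω L).subtype)

/-- The free nilpotent Lie algebra of class 2 on `d` generators over `Ω`:
the quotient of the free Lie algebra `F` on `d` generators by `[[F,F],F]`. -/
abbrev freeNilpotentClassTwo (Ω : Type*) [Field Ω] (d : ℕ) :=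
  FreeLieAlgebra Ω (Fin d) ⧸
    LieModule.lowerCentralSeries Ω (FreeLieAlgebra Ω (Fin d)) (FreeLieAlgebra Ω (Fin d)) 2

/-- The `i`-th canonical generator `xᵢ` of the free nilpotent Lie algebra of class 2. -/
noncomputable def freeNilpotentClassTwo.x (Ω : Type*) [Field Ω] (d : ℕ) (i : Fin d) :
    freeNilpotentClassTwo Ω d :=
  LieSubmodule.Quotient.mk (FreeLieAlgebra.of Ω i)

section Helpers

universe u

/-- The abelian Lie algebra `Ω ^ d`. -/
def AbV (Ω : Type*) (d : ℕ) := Fin d → Ω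

namespace AbV

instance (Ω : Type*) [Field Ω] (d : ℕ) : AddCommGroup (AbV Ω d) :=
  inferInstanceAs (AddCommGroup (Fin d → Ω))

instance (Ω : Type*) [Field Ω] (d : ℕ) : Module Ω (AbV Ω d) :=
  inferInstanceAs (Module Ω (Fin d → Ω))

instance (Ω : Type*) [Field Ω] (d : ℕ) : LieRing (AbV Ω d) where
  bracket _ _ := 0
  add_lie _ _ _ := (add_zero 0).symm
  lie_add _ _ _ := (add_zero 0).symm
  lie_self _ := rfl
  leibniz_lie _ _ _ := (add_zero 0).symm

theorem lie_eq {Ω : Type*} [Field Ω] {d : ℕ} (x y : AbV Ω d) : ⁅x, y⁆ = 0 := rfl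

instance (Ω : Type*) [Field Ω] (d : ℕ) : LieAlgebra Ω (AbV Ω d) where
  lie_smul t _ _ := (smul_zero t).symm

theorem add_apply {Ω : Type*} [Field Ω] {d : ℕ} (x y : AbV Ω d) (i : Fin d) :
    (x + y) i = x i + y i := rfl

theorem smul_apply {Ω : Type*} [Field Ω] {d : ℕ} (a : Ω) (x : AbV Ω d) (i : Fin d) :
    (a • x) i = a * x i := rfl

theorem zero_apply {Ω : Type*} [Field Ω] {d : ℕ} (i : Fin d) :
    (0 : AbV Ω d) i = 0 := rfl

end AbV

/-- The central extension of `L` by `Ω` defined by a 2-cocycle. -/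
def CExt (Ω : Type*) [Field Ω] (L : Type*) [LieRing L] [LieAlgebra Ω L]
    (_ : twoCocycles Ω L) := L × Ω

namespace CExt

variable {Ω : Type*} [Field Ω] {L : Type*} [LieRing L] [LieAlgebra Ω L] (f : twoCocycles Ω L)

instance : AddCommGroup (CExt Ω L f) := inferInstanceAs (AddCommGroup (L × Ω))

instance : Module Ω (CExt Ω L f) := inferInstanceAs (Module Ω (L × Ω))

instance : Bracket (CExt Ω L f) (CExt Ω L f) where
  bracket x y := ((⁅x.1, y.1⁆, f.1 x.1 y.1) : L × Ω)

theorem ext' {x y : CExt Ω L f} (h1 : x.1 = y.1) (h2 : x.2 = y.2) : x = y := Prod.ext h1 h2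

theorem add_fst (x y : CExt Ω L f) : (x + y).1 = x.1 + y.1 := rfl
theorem add_snd (x y : CExt Ω L f) : (x + y).2 = x.2 + y.2 := rfl
theorem zero_fst : (0 : CExt Ω L f).1 = 0 := rfl
theorem zero_snd : (0 : CExt Ω L f).2 = 0 := rfl
theorem smul_fst (a : Ω) (x : CExt Ω L f) : (a • x).1 = a • x.1 := rfl
theorem smul_snd (a : Ω) (x : CExt Ω L f) : (a • x).2 = a * x.2 := rfl
theorem lie_fst (x y : CExt Ω L f) : (⁅x, y⁆).1 = ⁅x.1, y.1⁆ := rfl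
theorem lie_snd (x y : CExt Ω L f) : (⁅x, y⁆).2 = f.1 x.1 y.1 := rfl

theorem skew (x y : L) : f.1 x y = - f.1 y x := by
  obtain ⟨h1, h2, h3, h4, h5, h6⟩ := f.2
  have := h5 (x + y)
  rw [h1, h2, h2, h5, h5] at this
  linear_combination this

instance : LieRing (CExt Ω L f) where
  add_lie x y z := by
    obtain ⟨h1, h2, h3, h4, h5, h6⟩ := f.2
    apply ext'
    · simp only [lie_fst, add_fst, add_lie]
    · simp only [lie_snd, add_fst, add_snd, h1]
  lie_add x y z := by
    obtain ⟨h1, h2, h3, h4, h5, h6⟩ := f.2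
    apply ext'
    · simp only [lie_fst, add_fst, lie_add]
    · simp only [lie_snd, add_fst, add_snd, h2]
  lie_self x := by
    obtain ⟨h1, h2, h3, h4, h5, h6⟩ := f.2
    apply ext'
    · simp only [lie_fst, zero_fst, lie_self]
    · simp only [lie_snd, zero_snd, h5]
  leibniz_lie x y z := by
    obtain ⟨h1, h2, h3, h4, h5, h6⟩ := f.2
    apply ext'
    · exact leibniz_lie x.1 y.1 z.1
    · simp only [lie_snd, lie_fst, add_snd]
      have h := h6 x.1 y.1 z.1
      have e1 := skew f x.1 ⁅y.1, z.1⁆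
      have e2 := skew f y.1 ⁅x.1, z.1⁆
      have e3 : f.1 ⁅z.1, x.1⁆ y.1 = - f.1 ⁅x.1, z.1⁆ y.1 := by
        rw [← lie_skew, ← neg_one_smul Ω, h3]; ring
      linear_combination e1 - e2 - h + e3

instance : LieAlgebra Ω (CExt Ω L f) where
  lie_smul t x y := by
    obtain ⟨h1, h2, h3, h4, h5, h6⟩ := f.2
    apply ext'
    · simp only [lie_fst, smul_fst, lie_smul]
    · simp only [lie_snd, smul_fst, smul_snd, h4]

/-- The projection to `L`. -/
def fstHom : CExt Ω L f →ₗ⁅Ω⁆ L where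
  toFun x := x.1
  map_add' _ _ := rfl
  map_smul' _ _ := rfl
  map_lie' := rfl

/-- The linear projection to `Ω`. -/
def sndLin : CExt Ω L f →ₗ[Ω] Ω where
  toFun x := x.2
  map_add' _ _ := rfl
  map_smul' _ _ := rfl

end CExt

/-- The four indices in the `k`-th block. -/
def blk {n d : ℕ} (hd : 4 * n < d) (k : Fin n) (r : Fin 4) : Fin d :=
  ⟨4 * k.1 + r.1, by have := k.2; have := r.2; omega⟩

/-- The data of the universal property of `L_d / M`. -/
structure IsUniv (Ω : Type u) [Field Ω] {n d : ℕ} (hd : 4 * n < d)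
    (Q : Type u) [LieRing Q] [LieAlgebra Ω Q] (X : Fin d → Q) : Prop where
  nil : ∀ x y z : Q, ⁅⁅x, y⁆, z⁆ = 0
  rel : ∀ k : Fin n, ⁅X (blk hd k 0), X (blk hd k 1)⁆ + ⁅X (blk hd k 2), X (blk hd k 3)⁆ = 0
  ext : ∀ (K : Type u) [LieRing K] [LieAlgebra Ω K] (φ ψ : Q →ₗ⁅Ω⁆ K), (∀ i, φ (X i) = ψ (X i)) → φ = ψ
  lift : ∀ (K : Type u) [LieRing K] [LieAlgebra Ω K] (Y : Fin d → K),
    (∀ x y z : K, ⁅⁅x, y⁆, z⁆ = 0) →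
    (∀ k : Fin n, ⁅Y (blk hd k 0), Y (blk hd k 1)⁆ + ⁅Y (blk hd k 2), Y (blk hd k 3)⁆ = 0) →
    ∃ φ : Q →ₗ⁅Ω⁆ K, ∀ i, φ (X i) = Y i

theorem isUniv_quotient (Ω : Type u) [Field Ω] {n d : ℕ} (hd : 4 * n < d)
    (M : LieIdeal Ω (freeNilpotentClassTwo Ω d))
    (hM : M = LieSubmodule.lieSpan Ω (freeNilpotentClassTwo Ω d)
      {w | ∃ k : Fin n,
        w = ⁅freeNilpotentClassTwo.x Ω d (blk hd k 0), freeNilpotentClassTwo.x Ω d (blk hd k 1)⁆ +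
          ⁅freeNilpotentClassTwo.x Ω d (blk hd k 2), freeNilpotentClassTwo.x Ω d (blk hd k 3)⁆}) :
    IsUniv Ω hd ((freeNilpotentClassTwo Ω d) ⧸ M)
      (fun i => LieSubmodule.Quotient.mk (freeNilpotentClassTwo.x Ω d i)) where
  nil := by
    intro x y z
    obtain ⟨x, rfl⟩ := Submodule.Quotient.mk_surjective _ x
    obtain ⟨y, rfl⟩ := Submodule.Quotient.mk_surjective _ y
    obtain ⟨z, rfl⟩ := Submodule.Quotient.mk_surjective _ z
    obtain ⟨x, rfl⟩ := Submodule.Quotient.mk_surjective _ x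
    obtain ⟨y, rfl⟩ := Submodule.Quotient.mk_surjective _ y
    obtain ⟨z, rfl⟩ := Submodule.Quotient.mk_surjective _ z
    have h : ⁅⁅x, y⁆, z⁆ ∈ LieModule.lowerCentralSeries Ω (FreeLieAlgebra Ω (Fin d))
        (FreeLieAlgebra Ω (Fin d)) 2 := by
      rw [← lie_skew]
      apply neg_mem
      rw [LieModule.lowerCentralSeries_succ]
      apply LieSubmodule.lie_mem_lie (LieSubmodule.mem_top _)
      rw [LieModule.lowerCentralSeries_succ]
      exact LieSubmodule.lie_mem_lie (LieSubmodule.mem_top _) (LieSubmodule.mem_top _)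
    have h' : (LieSubmodule.Quotient.mk ⁅⁅x, y⁆, z⁆ : freeNilpotentClassTwo Ω d) = 0 :=
      LieSubmodule.Quotient.mk_eq_zero'.2 h
    exact (congrArg (LieSubmodule.Quotient.mk (N := M)) h').trans rfl
  rel := by
    intro k
    have h : (⁅freeNilpotentClassTwo.x Ω d (blk hd k 0), freeNilpotentClassTwo.x Ω d (blk hd k 1)⁆ +
          ⁅freeNilpotentClassTwo.x Ω d (blk hd k 2), freeNilpotentClassTwo.x Ω d (blk hd k 3)⁆)
          ∈ M := by
      rw [hM]
      exact LieSubmodule.subset_lieSpan ⟨k, rfl⟩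
    exact LieSubmodule.Quotient.mk_eq_zero'.2 h
  ext := by
    intro K _ _ φ ψ h
    let p : FreeLieAlgebra Ω (Fin d) →ₗ⁅Ω⁆ ((freeNilpotentClassTwo Ω d) ⧸ M) :=
      { toFun := fun a => LieSubmodule.Quotient.mk (LieSubmodule.Quotient.mk a)
        map_add' := fun _ _ => rfl
        map_smul' := fun _ _ => rfl
        map_lie' := rfl }
    have e : φ.comp p = ψ.comp p := FreeLieAlgebra.hom_ext (fun i => h i)
    ext x
    obtain ⟨x, rfl⟩ := Submodule.Quotient.mk_surjective _ x
    obtain ⟨x, rfl⟩ := Submodule.Quotient.mk_surjective _ x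
    exact LieHom.congr_fun e x
  lift := by
    intro K _ _ Y hK hY
    let F := FreeLieAlgebra.lift Ω Y
    have hF : (LieModule.lowerCentralSeries Ω (FreeLieAlgebra Ω (Fin d))
        (FreeLieAlgebra Ω (Fin d)) 2) ≤ F.ker := by
      rw [LieModule.lowerCentralSeries_succ, LieSubmodule.lieIdeal_oper_eq_span,
        LieSubmodule.lieSpan_le]
      rintro _ ⟨a, b, rfl⟩
      have key : ∀ b ∈ LieModule.lowerCentralSeries Ω (FreeLieAlgebra Ω (Fin d))
          (FreeLieAlgebra Ω (Fin d)) 1, ∀ z : K, ⁅F b, z⁆ = 0 := by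
        intro b hb
        rw [LieModule.lowerCentralSeries_succ, ← LieSubmodule.mem_toSubmodule,
          LieSubmodule.lieIdeal_oper_eq_linear_span] at hb
        induction hb using Submodule.span_induction with
        | mem x hx =>
          obtain ⟨a, b, rfl⟩ := hx
          intro z
          rw [LieHom.map_lie, hK]
        | zero => intro z; simp
        | add x y _ _ hx hy => intro z; rw [map_add, add_lie, hx, hy, add_zero]
        | smul c x _ hx => intro z; rw [map_smul, smul_lie, hx, smul_zero]
      have h1 : F ⁅(a : FreeLieAlgebra Ω (Fin d)), (b : FreeLieAlgebra Ω (Fin d))⁆ = 0 := by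
        rw [LieHom.map_lie, ← lie_skew, key b.1 b.2, neg_zero]
      exact h1
    let G : freeNilpotentClassTwo Ω d →ₗ⁅Ω⁆ K :=
      { Submodule.liftQ _ (F : FreeLieAlgebra Ω (Fin d) →ₗ[Ω] K) (fun x hx => hF hx) with
        map_lie' := by
          intro x y
          obtain ⟨x, rfl⟩ := Submodule.Quotient.mk_surjective _ x
          obtain ⟨y, rfl⟩ := Submodule.Quotient.mk_surjective _ y
          exact LieHom.map_lie F x y }
    have hG : ∀ i, G (freeNilpotentClassTwo.x Ω d i) = Y i := fun i =>
      FreeLieAlgebra.lift_of_apply Y i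
    have hGM : M ≤ G.ker := by
      rw [hM, LieSubmodule.lieSpan_le]
      rintro _ ⟨k, rfl⟩
      have : G (⁅freeNilpotentClassTwo.x Ω d (blk hd k 0), freeNilpotentClassTwo.x Ω d (blk hd k 1)⁆ +
          ⁅freeNilpotentClassTwo.x Ω d (blk hd k 2), freeNilpotentClassTwo.x Ω d (blk hd k 3)⁆) = 0 := by
        rw [map_add, LieHom.map_lie, LieHom.map_lie, hG, hG, hG, hG, hY]
      exact this
    let H : (freeNilpotentClassTwo Ω d ⧸ M) →ₗ⁅Ω⁆ K :=
      { Submodule.liftQ _ (G : freeNilpotentClassTwo Ω d →ₗ[Ω] K) (fun x hx => hGM hx) with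
        map_lie' := by
          intro x y
          obtain ⟨x, rfl⟩ := Submodule.Quotient.mk_surjective _ x
          obtain ⟨y, rfl⟩ := Submodule.Quotient.mk_surjective _ y
          exact LieHom.map_lie G x y }
    exact ⟨H, hG⟩

/-- Pull back a 2-cocycle along a Lie algebra morphism. -/
def pullCocycle {Ω : Type u} [Field Ω] {Q K : Type u} [LieRing Q] [LieAlgebra Ω Q]
    [LieRing K] [LieAlgebra Ω K] (π : Q →ₗ⁅Ω⁆ K) (g : twoCocycles Ω K) : twoCocycles Ω Q :=
  ⟨fun x y => g.1 (π x) (π y), by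
    obtain ⟨h1, h2, h3, h4, h5, h6⟩ := g.2
    refine ⟨fun x x' y => ?_, fun x y y' => ?_, fun a x y => ?_, fun a x y => ?_,
      fun x => ?_, fun x y z => ?_⟩
    · simp only [map_add, h1]
    · simp only [map_add, h2]
    · simp only [map_smul, h3]
    · simp only [map_smul, h4]
    · exact h5 _
    · simp only [LieHom.map_lie, h6]⟩

/-- The cocycle on the abelian Lie algebra given by a 2 × 2 minor. -/
def mform (Ω : Type u) [Field Ω] {d : ℕ} (i j : Fin d) : twoCocycles Ω (AbV Ω d) :=
  ⟨fun u v => u i * v j - u j * v i, by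
    refine ⟨fun x x' y => ?_, fun x y y' => ?_, fun a x y => ?_, fun a x y => ?_,
      fun x => ?_, fun x y z => ?_⟩ <;>
    simp only [AbV.add_apply, AbV.smul_apply, AbV.lie_eq, AbV.zero_apply] <;> ring⟩

/-- Standard basis. -/
def stdE (Ω : Type u) [Field Ω] {d : ℕ} (a : Fin d) : AbV Ω d := fun i => if i = a then 1 else 0

/-- Value of a cocycle on the `k`-th relator. -/
def relVal {Ω : Type u} [Field Ω] {n d : ℕ} (hd : 4 * n < d) {K : Type u} [LieRing K]
    [LieAlgebra Ω K] (X : Fin d → K) : twoCocycles Ω K →ₗ[Ω] (Fin n → Ω) where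
  toFun f k := f.1 (X (blk hd k 0)) (X (blk hd k 1)) + f.1 (X (blk hd k 2)) (X (blk hd k 3))
  map_add' f g := by
    ext k
    simp only [Submodule.coe_add, Pi.add_apply]
    ring
  map_smul' a f := by
    ext k
    simp only [Submodule.coe_smul, Pi.smul_apply, smul_eq_mul, RingHom.id_apply]
    ring

section

variable {Ω : Type u} [Field Ω] {n d : ℕ} {hd : 4 * n < d}

theorem relVal_mform_eq_zero (i j : Fin d)
    (h1 : ∀ k, ¬ (i = blk hd k 0 ∧ j = blk hd k 1)) (h2 : ∀ k, ¬ (j = blk hd k 0 ∧ i = blk hd k 1))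
    (h3 : ∀ k, ¬ (i = blk hd k 2 ∧ j = blk hd k 3)) (h4 : ∀ k, ¬ (j = blk hd k 2 ∧ i = blk hd k 3)) :
    relVal hd (stdE Ω) (mform Ω i j) = 0 := by
  ext k
  specialize h1 k; specialize h2 k; specialize h3 k; specialize h4 k
  simp only [relVal, mform, stdE, LinearMap.coe_mk, AddHom.coe_mk] at *
  simp only [Pi.zero_apply]
  split_ifs <;> simp_all

theorem relVal_mform01 (k : Fin n) :
    relVal hd (stdE Ω) (mform Ω (blk hd k 0) (blk hd k 1)) = Pi.single k 1 := by
  ext l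
  by_cases h : k = l
  · subst h
    simp [relVal, mform, stdE, blk]
  · have : k.1 ≠ l.1 := fun h' => h (Fin.ext h')
    rw [Pi.single_eq_of_ne (Ne.symm h)]
    simp [relVal, mform, stdE, blk]
    grind

theorem relVal_mform23 (k : Fin n) :
    relVal hd (stdE Ω) (mform Ω (blk hd k 2) (blk hd k 3)) = Pi.single k 1 := by
  ext l
  by_cases h : k = l
  · subst h
    simp [relVal, mform, stdE, blk]
  · have : k.1 ≠ l.1 := fun h' => h (Fin.ext h')
    rw [Pi.single_eq_of_ne (Ne.symm h)]
    simp [relVal, mform, stdE, blk]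
    grind

theorem cocycle_eq_zero_of_minors (g : twoCocycles Ω (AbV Ω d)) (u v : AbV Ω d)
    (h : ∀ i j, u i * v j - u j * v i = 0) : g.1 u v = 0 := by
  obtain ⟨h1, h2, h3, h4, h5, h6⟩ := g.2
  by_cases hu : u = 0
  · subst hu
    have := h3 0 0 v
    rwa [zero_smul, zero_mul] at this
  · obtain ⟨i, hi⟩ : ∃ i, u i ≠ 0 := by
      by_contra hc
      push Not at hc
      exact hu (funext hc)
    have hv : v = (v i / u i) • u := by
      funext j
      rw [AbV.smul_apply]
      field_simp
      linear_combination h i j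
    rw [hv, h4, h5, mul_zero]

variable {Q : Type u} [LieRing Q] [LieAlgebra Ω Q] {X : Fin d → Q}

theorem exists_sigma (U : IsUniv Ω hd Q X) {K : Type u} [LieRing K] [LieAlgebra Ω K]
    (hK : ∀ x y z : K, ⁅⁅x, y⁆, z⁆ = 0) (π : Q →ₗ⁅Ω⁆ K) (g : twoCocycles Ω K)
    (hg : ∀ x y z : K, g.1 ⁅x, y⁆ z = 0) (hr : relVal hd (fun i => π (X i)) g = 0) :
    ∃ σ : Q →ₗ[Ω] Ω, ∀ x y, σ ⁅x, y⁆ = g.1 (π x) (π y) := by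
  obtain ⟨φ, hφ⟩ := U.lift (CExt Ω K g) (fun i => ((π (X i), 0) : K × Ω))
    (fun x y z => CExt.ext' g (hK _ _ _) (hg _ _ _))
    (fun k => CExt.ext' g (by
      change ⁅π _, π _⁆ + ⁅π _, π _⁆ = 0
      rw [← LieHom.map_lie, ← LieHom.map_lie, ← map_add, U.rel, map_zero]) (congrFun hr k))
  have e : (CExt.fstHom g).comp φ = π := U.ext K _ _ (fun i => by
    rw [LieHom.comp_apply, hφ]; rfl)
  refine ⟨(CExt.sndLin g).comp (φ : Q →ₗ[Ω] CExt Ω K g), fun x y => ?_⟩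
  have e' : ∀ x, (φ x).1 = π x := fun x => LieHom.congr_fun e x
  change (φ ⁅x, y⁆).2 = _
  rw [LieHom.map_lie, CExt.lie_snd, e', e']

theorem exists_pi (U : IsUniv Ω hd Q X) : ∃ π : Q →ₗ⁅Ω⁆ AbV Ω d, ∀ i, π (X i) = stdE Ω i :=
  U.lift _ _ (fun _ _ _ => rfl) (fun _ => add_zero 0)

theorem form_vanish (U : IsUniv Ω hd Q X) (π : Q →ₗ⁅Ω⁆ AbV Ω d) (hπ : ∀ i, π (X i) = stdE Ω i)
    (g : twoCocycles Ω (AbV Ω d)) (hr : relVal hd (stdE Ω) g = 0) (x y : Q) (hxy : ⁅x, y⁆ = 0) :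
    g.1 (π x) (π y) = 0 := by
  obtain ⟨σ, hσ⟩ := exists_sigma U (fun _ _ _ => rfl) π g (fun x y z => by
    obtain ⟨h1, h2, h3, h4, h5, h6⟩ := g.2
    rw [AbV.lie_eq]
    have := h3 0 0 z
    rwa [zero_smul, zero_mul] at this) (by simpa only [hπ] using hr)
  rw [← hσ, hxy, map_zero]

theorem minors_vanish (U : IsUniv Ω hd Q X) (π : Q →ₗ⁅Ω⁆ AbV Ω d) (hπ : ∀ i, π (X i) = stdE Ω i)
    (x y : Q) (hxy : ⁅x, y⁆ = 0) (i j : Fin d) :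
    π x i * π y j - π x j * π y i = 0 := by
  have gen : ∀ i j : Fin d, (∀ k, ¬ (i = blk hd k 0 ∧ j = blk hd k 1)) →
      (∀ k, ¬ (j = blk hd k 0 ∧ i = blk hd k 1)) →
      (∀ k, ¬ (i = blk hd k 2 ∧ j = blk hd k 3)) →
      (∀ k, ¬ (j = blk hd k 2 ∧ i = blk hd k 3)) → π x i * π y j - π x j * π y i = 0 :=
    fun i j h1 h2 h3 h4 =>
      form_vanish U π hπ (mform Ω i j) (relVal_mform_eq_zero i j h1 h2 h3 h4) x y hxy
  have key : ∀ k : Fin n,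
      π x (blk hd k 0) * π y (blk hd k 1) - π x (blk hd k 1) * π y (blk hd k 0) = 0 ∧
      π x (blk hd k 2) * π y (blk hd k 3) - π x (blk hd k 3) * π y (blk hd k 2) = 0 := by
    intro k
    have h02 := gen (blk hd k 0) (blk hd k 2) (by simp [blk]; omega) (by simp [blk]; omega)
      (by simp [blk]; omega) (by simp [blk]; omega)
    have h03 := gen (blk hd k 0) (blk hd k 3) (by simp [blk]; omega) (by simp [blk]; omega)
      (by simp [blk]; omega) (by simp [blk]; omega)
    have h12 := gen (blk hd k 1) (blk hd k 2) (by simp [blk]; omega) (by simp [blk]; omega)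
      (by simp [blk]; omega) (by simp [blk]; omega)
    have h13 := gen (blk hd k 1) (blk hd k 3) (by simp [blk]; omega) (by simp [blk]; omega)
      (by simp [blk]; omega) (by simp [blk]; omega)
    have hs := form_vanish U π hπ
      (mform Ω (blk hd k 0) (blk hd k 1) - mform Ω (blk hd k 2) (blk hd k 3))
      (by rw [map_sub, relVal_mform01, relVal_mform23, sub_self]) x y hxy
    have hs' : (π x (blk hd k 0) * π y (blk hd k 1) - π x (blk hd k 1) * π y (blk hd k 0)) -
      (π x (blk hd k 2) * π y (blk hd k 3) - π x (blk hd k 3) * π y (blk hd k 2)) = 0 := hs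
    generalize π x (blk hd k 0) = a0 at *
    generalize π x (blk hd k 1) = a1 at *
    generalize π x (blk hd k 2) = a2 at *
    generalize π x (blk hd k 3) = a3 at *
    generalize π y (blk hd k 0) = b0 at *
    generalize π y (blk hd k 1) = b1 at *
    generalize π y (blk hd k 2) = b2 at *
    generalize π y (blk hd k 3) = b3 at *
    have hsq : (a0 * b1 - a1 * b0) ^ 2 = 0 := by
      linear_combination (a0 * b1 - a1 * b0) * hs' + (a1 * b3 - a3 * b1) * h02
        - (a1 * b2 - a2 * b1) * h03
    have h01 : a0 * b1 - a1 * b0 = 0 := pow_eq_zero_iff (two_ne_zero) |>.1 hsq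
    exact ⟨h01, by linear_combination h01 - hs'⟩
  by_cases h1 : ∃ k, i = blk hd k 0 ∧ j = blk hd k 1
  · obtain ⟨k, rfl, rfl⟩ := h1
    exact (key k).1
  by_cases h2 : ∃ k, j = blk hd k 0 ∧ i = blk hd k 1
  · obtain ⟨k, rfl, rfl⟩ := h2
    linear_combination -(key k).1
  by_cases h3 : ∃ k, i = blk hd k 2 ∧ j = blk hd k 3
  · obtain ⟨k, rfl, rfl⟩ := h3
    exact (key k).2
  by_cases h4 : ∃ k, j = blk hd k 2 ∧ i = blk hd k 3
  · obtain ⟨k, rfl, rfl⟩ := h4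
    linear_combination -(key k).2
  exact gen i j (not_exists.1 h1) (not_exists.1 h2) (not_exists.1 h3) (not_exists.1 h4)

theorem exists_lie_ne_zero (U : IsUniv Ω hd Q X) (hn : 1 ≤ n) : ∃ x y : Q, ⁅x, y⁆ ≠ 0 := by
  obtain ⟨π, hπ⟩ := exists_pi U
  refine ⟨X (blk hd ⟨0, hn⟩ 0), X (blk hd ⟨0, hn⟩ 2), fun h => ?_⟩
  have := minors_vanish U π hπ _ _ h (blk hd ⟨0, hn⟩ 0) (blk hd ⟨0, hn⟩ 2)
  rw [hπ, hπ] at this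
  simp [stdE, blk] at this

theorem finrank_B0 (U : IsUniv Ω hd Q X) : Module.finrank Ω (B0 Ω Q) = n := by
  obtain ⟨π, hπ⟩ := exists_pi U
  have hker : twoCoboundariesIn Ω Q ≤ LinearMap.ker (relVal hd X) := by
    rintro f ⟨σ, hσ⟩
    rw [LinearMap.mem_ker]
    ext k
    change f.1 _ _ + f.1 _ _ = 0
    have hσ' : ∀ x y, f.1 x y = -σ ⁅x, y⁆ := hσ
    rw [hσ', hσ', ← neg_add, ← map_add, U.rel, map_zero, neg_zero]
  let Eb : lieH2 Ω Q →ₗ[Ω] (Fin n → Ω) := (twoCoboundariesIn Ω Q).liftQ (relVal hd X) hker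
  let T : B0 Ω Q →ₗ[Ω] (Fin n → Ω) := Eb.domRestrict (B0 Ω Q)
  have hinj : Function.Injective T := by
    rw [injective_iff_map_eq_zero]
    rintro ⟨_, f, hf, rfl⟩ h0
    have hf' : ∀ x y, ⁅x, y⁆ = 0 → f.1 x y = 0 := hf
    have h0' : relVal hd X f = 0 := h0
    obtain ⟨σ, hσ⟩ := exists_sigma U U.nil (LieHom.id : Q →ₗ⁅Ω⁆ Q) f
      (fun x y z => hf' _ _ (U.nil x y z)) h0'
    apply Subtype.ext
    apply (Submodule.Quotient.mk_eq_zero _).2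
    refine ⟨-σ, fun x y => ?_⟩
    rw [LinearMap.neg_apply, neg_neg]
    exact (hσ x y).symm
  have hsurj : Function.Surjective T := by
    intro c
    let g : twoCocycles Ω (AbV Ω d) := ∑ k, c k • mform Ω (blk hd k 0) (blk hd k 1)
    have hgc : relVal hd (stdE Ω) g = c := by
      simp only [g, map_sum, map_smul, relVal_mform01]
      ext l
      simp [Finset.sum_apply, Pi.single_apply]
    refine ⟨⟨(twoCoboundariesIn Ω Q).mkQ (pullCocycle π g), pullCocycle π g, ?_, rfl⟩, ?_⟩
    · intro x y hxy
      exact cocycle_eq_zero_of_minors g _ _ (minors_vanish U π hπ x y hxy)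
    · change relVal hd X (pullCocycle π g) = c
      rw [← hgc]
      ext k
      change g.1 (π _) (π _) + g.1 (π _) (π _) = _
      simp only [hπ]
      rfl
  rw [(LinearEquiv.ofBijective T ⟨hinj, hsurj⟩).finrank_eq, Module.finrank_fin_fun]

end

end Helpers

/-- Let `n ≥ 1`, `d > 4n`, let `L_d` be the free nilpotent Lie algebra of class 2 on
`d` generators `x₁, …, x_d` over `Ω`, and let `M` be the ideal generated by the
elements `⁅x_{4k+1}, x_{4k+2}⁆ + ⁅x_{4k+3}, x_{4k+4}⁆`, `k = 0, …, n-1` (written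
here with 0-based indices).  Then `L_d/M` is nilpotent of class 2 and its Bogomolov
multiplier `B₀(L_d/M)` has dimension exactly `n` over `Ω`. -/
theorem bogomolov_dim_eq_of_quotient
    (Ω : Type*) [Field Ω] (n d : ℕ) (hn : 1 ≤ n) (hd : 4 * n < d)
    (M : LieIdeal Ω (freeNilpotentClassTwo Ω d))
    (hM : M = LieSubmodule.lieSpan Ω (freeNilpotentClassTwo Ω d)
      {w | ∃ k : Fin n,
        w = ⁅freeNilpotentClassTwo.x Ω d ⟨4 * k.1, by have := k.2; omega⟩,
              freeNilpotentClassTwo.x Ω d ⟨4 * k.1 + 1, by have := k.2; omega⟩⁆ +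
            ⁅freeNilpotentClassTwo.x Ω d ⟨4 * k.1 + 2, by have := k.2; omega⟩,
              freeNilpotentClassTwo.x Ω d ⟨4 * k.1 + 3, by have := k.2; omega⟩⁆}) :
    (∀ x y z : (freeNilpotentClassTwo Ω d) ⧸ M, ⁅⁅x, y⁆, z⁆ = 0) ∧
    (∃ x y : (freeNilpotentClassTwo Ω d) ⧸ M, ⁅x, y⁆ ≠ 0) ∧
    Module.finrank Ω ↥(B0 Ω ((freeNilpotentClassTwo Ω d) ⧸ M)) = n := by
  have U := isUniv_quotient Ω hd M hM
  exact ⟨U.nil, exists_lie_ne_zero U hn, finrank_B0 U⟩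
end

section
/- Let n > 0 and let L_{2n} be the free nilpotent Lie algebra of class 2 on 2n generators x₁,…,x_{2n} over a field Ω. Let M be the ideal of L_{2n} generated by the elements [x_{2r−1}, x_{2r}] − [x_{2s−1}, x_{2s}] for 1 ≤ r < s ≤ n together with the elements [x_t, x_u] for 1 ≤ t < u ≤ 2n with (t,u) ≠ (2i−1, 2i) for every i ≤ n. Then M ∩ L_{2n}' = ⟨K(L_{2n}) ∩ M⟩, i.e., every element of M lying in the derived subalgebra of L_{2n} is a linear combination of brackets of elements of L_{2n} that lie in M. -/
variable (Ω : Type*) [Field Ω] (L : Type*) [LieRing L] [LieAlgebra Ω L]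

/-- Let `L_{2n}` (`n > 0`) be the free nilpotent Lie algebra of class 2 on `2n`
generators `x₁, …, x_{2n}` over `Ω` and let `M` be the ideal generated by the
elements `⁅x_{2r-1}, x_{2r}⁆ - ⁅x_{2s-1}, x_{2s}⁆` (`1 ≤ r < s ≤ n`) together with
the `⁅x_t, x_u⁆` (`1 ≤ t < u ≤ 2n`, `(t,u) ≠ (2i-1, 2i)` for every `i`), all written
here with 0-based indices.  Then `M ∩ L_{2n}' = ⟨K(L_{2n}) ∩ M⟩`. -/
theorem ideal_inter_derived_eq_span_brackets
    (Ω : Type*) [Field Ω] (n : ℕ) (hn : 0 < n)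
    (M : LieIdeal Ω (freeNilpotentClassTwo Ω (2 * n)))
    (hM : M = LieSubmodule.lieSpan Ω (freeNilpotentClassTwo Ω (2 * n))
      {w | (∃ r s : Fin n, r < s ∧
              w = ⁅freeNilpotentClassTwo.x Ω (2 * n) ⟨2 * r.1, by have := r.2; omega⟩,
                    freeNilpotentClassTwo.x Ω (2 * n) ⟨2 * r.1 + 1, by have := r.2; omega⟩⁆ -
                  ⁅freeNilpotentClassTwo.x Ω (2 * n) ⟨2 * s.1, by have := s.2; omega⟩,
                    freeNilpotentClassTwo.x Ω (2 * n) ⟨2 * s.1 + 1, by have := s.2; omega⟩⁆) ∨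
            (∃ t u : Fin (2 * n), t < u ∧ (¬ ∃ i : ℕ, t.1 = 2 * i ∧ u.1 = 2 * i + 1) ∧
              w = ⁅freeNilpotentClassTwo.x Ω (2 * n) t, freeNilpotentClassTwo.x Ω (2 * n) u⁆)}) :
    (M : Submodule Ω (freeNilpotentClassTwo Ω (2 * n))) ⊓
        Submodule.span Ω (bracketSet (freeNilpotentClassTwo Ω (2 * n))) =
      Submodule.span Ω (bracketSet (freeNilpotentClassTwo Ω (2 * n)) ∩
        (M : Set (freeNilpotentClassTwo Ω (2 * n)))) := by
  classical
  have hsub : ∀ m ∈ Submodule.span Ω (bracketSet (freeNilpotentClassTwo Ω (2 * n)) ∩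
        (M : Set (freeNilpotentClassTwo Ω (2 * n)))), m ∈ M := by
    intro m hm
    have h : Submodule.span Ω (bracketSet (freeNilpotentClassTwo Ω (2 * n)) ∩
        (M : Set (freeNilpotentClassTwo Ω (2 * n)))) ≤
        (M : Submodule Ω (freeNilpotentClassTwo Ω (2 * n))) :=
      Submodule.span_le.2 (fun z hz => hz.2)
    exact h hm
  apply le_antisymm
  · rintro z ⟨hz, -⟩
    let S : LieSubmodule Ω (freeNilpotentClassTwo Ω (2 * n)) (freeNilpotentClassTwo Ω (2 * n)) :=
      { Submodule.span Ω (bracketSet (freeNilpotentClassTwo Ω (2 * n)) ∩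
          (M : Set (freeNilpotentClassTwo Ω (2 * n)))) with
        lie_mem := fun {x m} hm =>
          Submodule.subset_span ⟨⟨x, m, rfl⟩, LieSubmodule.lie_mem M (hsub m hm)⟩ }
    have hgen : ∀ t u : Fin (2 * n), t < u → (¬ ∃ i : ℕ, t.1 = 2 * i ∧ u.1 = 2 * i + 1) →
        ⁅freeNilpotentClassTwo.x Ω (2 * n) t, freeNilpotentClassTwo.x Ω (2 * n) u⁆ ∈ M := by
      intro t u h1 h2
      rw [hM]
      exact LieSubmodule.subset_lieSpan (Or.inr ⟨t, u, h1, h2, rfl⟩)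
    have hK : ∀ x y : freeNilpotentClassTwo Ω (2 * n), ⁅x, y⁆ ∈ M → ⁅x, y⁆ ∈ S :=
      fun x y h => Submodule.subset_span ⟨⟨x, y, rfl⟩, h⟩
    have key : M ≤ S := by
      conv_lhs => rw [hM]
      rw [LieSubmodule.lieSpan_le]
      rintro w (⟨r, s, hrs, hw⟩ | ⟨t, u, h1, h2, rfl⟩)
      · have hwM : w ∈ M := by
          rw [hM]
          exact LieSubmodule.subset_lieSpan (Or.inl ⟨r, s, hrs, hw⟩)
        have hrs' : r.1 < s.1 := hrs
        have had := hgen ⟨2 * r.1, by have := r.2; omega⟩ ⟨2 * s.1 + 1, by have := s.2; omega⟩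
          (by simp only [Fin.mk_lt_mk]; omega) (by rintro ⟨i, h, h'⟩; dsimp only at h h'; omega)
        have hbc := hgen ⟨2 * r.1 + 1, by have := r.2; omega⟩ ⟨2 * s.1, by have := s.2; omega⟩
          (by simp only [Fin.mk_lt_mk]; omega) (by rintro ⟨i, h, h'⟩; dsimp only at h h'; omega)
        generalize freeNilpotentClassTwo.x Ω (2 * n) ⟨2 * r.1, _⟩ = a at *
        generalize freeNilpotentClassTwo.x Ω (2 * n) ⟨2 * r.1 + 1, _⟩ = b at *
        generalize freeNilpotentClassTwo.x Ω (2 * n) ⟨2 * s.1, _⟩ = c at *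
        generalize freeNilpotentClassTwo.x Ω (2 * n) ⟨2 * s.1 + 1, _⟩ = d at *
        have e : ⁅a + c, b - d⁆ = w - ⁅a, d⁆ - ⁅b, c⁆ := by
          rw [hw, add_lie, lie_sub, lie_sub, ← lie_skew c b]
          abel
        have h1 : ⁅a + c, b - d⁆ ∈ S := by
          apply hK
          rw [e]
          exact sub_mem (sub_mem hwM had) hbc
        have e2 : w = ⁅a + c, b - d⁆ + ⁅a, d⁆ + ⁅b, c⁆ := by
          rw [e]; abel
        rw [e2]
        exact add_mem (add_mem h1 (hK _ _ had)) (hK _ _ hbc)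
      · exact hK _ _ (hgen t u h1 h2)
    exact key hz
  · refine le_inf (fun m hm => hsub m hm) (Submodule.span_mono fun z hz => hz.1)
end
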